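/- Let m ≥ 2. The number M(q,m) of distinct G-orbits on the set I(q,m) of monic irreducible polynomials of degree m in 𝔽_q[x] is given by M(q,m) = (1/((q−1)·h·n·m)) · ∑_{λ ∈ 𝔽_q^×} ∑_{r=0}^{hn−1} ∑_{j=0}^{m−1} ∑_{d | m} μ(d) · N_{r,j}(m/d, λ). -/

import Mathlib

noncomputable section


/-- `N_{r,j}(s,λ)`: the number of `a ∈ 𝔽_{q^s}ˣ` (inside the ambient field `E = 𝔽_{q^m}`)
with `a^{p^r} = λ·a^{q^j}`, where `q = p^h`. -/
def Ncount (p h : ℕ) (F E : Type*) [Field F] [Field E] [Algebra F E]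
    (lam : F) (r j s : ℕ) : ℕ :=
  Nat.card {a : E // a ≠ 0 ∧ a ^ p ^ r = algebraMap F E lam * a ^ (p ^ h) ^ j ∧
    a ^ (p ^ h) ^ s = a}

/-- The action `g^{(λ,τ_r)}(x) = λ^{-m} g^{τ_r}(λx)` on polynomials over `F = 𝔽_q`,
where `τ_r : a ↦ a^{p^r}`. -/
def actFin (p : ℕ) {F : Type*} [Field F] (lam : F) (r m : ℕ) (g : Polynomial F) :
    Polynomial F :=
  ∑ i ∈ g.support, Polynomial.C ((lam ^ m)⁻¹ * g.coeff i ^ p ^ r * lam ^ i) *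
    Polynomial.X ^ i

/-- `I(q,m)`: the monic irreducible polynomials of degree `m` in `F[x]`. -/
def IrrSet (F : Type*) [Field F] (m : ℕ) : Set (Polynomial F) :=
  {g | g.Monic ∧ Irreducible g ∧ g.natDegree = m}

/-- The set of `G`-orbits on `I(q,m)`, where `G = 𝔽_qˣ ⋊ Gal(𝔽_{q^n}/𝔽_p)`. -/
def orbitSet (p h n m : ℕ) (F : Type*) [Field F] : Set (Set (Polynomial F)) :=
  {S | ∃ g ∈ IrrSet F m, S = {g' ∈ IrrSet F m |
    ∃ lam : F, lam ≠ 0 ∧ ∃ r < h * n, g' = actFin p lam r m g}}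

open Polynomial in
theorem aux_deg_dvd (p h : ℕ) (F E : Type*) [Field F] [Field E] [Fintype F] [Fintype E]
    [Algebra F E] (hF : Fintype.card F = p ^ h) (a : E) (s : ℕ) :
    (minpoly F a).natDegree ∣ s ↔ a ^ (p ^ h) ^ s = a := by
  have ha : IsIntegral F a := Algebra.IsIntegral.isIntegral a
  rw [(minpoly.irreducible ha).natDegree_dvd_iff_dvd_X_pow_card_pow_sub_X, minpoly.dvd_iff,
    Nat.card_eq_fintype_card, hF]
  simp [sub_eq_zero]

theorem aux_pow_inj (p : ℕ) (hp : p.Prime) (E : Type*) [Field E] [CharP E p] (s : ℕ) :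
    Function.Injective (fun a : E => a ^ p ^ s) := by
  have := Fact.mk hp
  have := iterateFrobenius_inj E p s
  intro a b hab
  apply this
  simpa [iterateFrobenius_def] using hab

theorem aux_exp_unique (p h m : ℕ) (hp : p.Prime) (F E : Type*) [Field F] [Field E] [Fintype F]
    [Fintype E] [Algebra F E] [CharP E p] (hF : Fintype.card F = p ^ h) (a : E)
    (ha : (minpoly F a).natDegree = m) (i j : ℕ) (hi : i < m) (hj : j < m)
    (hij : a ^ (p ^ h) ^ i = a ^ (p ^ h) ^ j) : i = j := by
  wlog hle : i ≤ j generalizing i j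
  · exact (this j i hj hi hij.symm (by omega)).symm
  obtain ⟨k, rfl⟩ := Nat.exists_eq_add_of_le hle
  have h1 : a ^ (p ^ h) ^ k = a := by
    apply aux_pow_inj p hp E (h * i)
    simp only
    rw [pow_mul, hij, ← pow_mul, ← pow_add, add_comm]
  rw [← aux_deg_dvd p h F E hF, ha] at h1
  rcases Nat.eq_zero_or_pos k with h0 | h0
  · omega
  · have := Nat.le_of_dvd h0 h1
    omega

theorem aux_conj (p h m : ℕ) (hp : p.Prime) (hm : 0 < m) (F E : Type*) [Field F] [Field E]
    [Fintype F]
    [Fintype E] [Algebra F E] [CharP F p] (hF : Fintype.card F = p ^ h) (a b : E)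
    (ha : (minpoly F a).natDegree = m) :
    minpoly F b = minpoly F a ↔ ∃ j < m, b = a ^ (p ^ h) ^ j := by
  have := Fact.mk hp
  constructor
  · intro hab
    have hc : IsConjRoot F b a := hab
    rw [isConjRoot_iff_exists_algEquiv] at hc
    obtain ⟨σ, hσ⟩ := hc
    obtain ⟨i, hi⟩ := FiniteField.exists_forall_apply_eq_pow F p E σ
    refine ⟨i % m, Nat.mod_lt _ hm, ?_⟩
    rw [← hσ, hi, Nat.card_eq_fintype_card, hF]
    conv_lhs => rw [← Nat.div_add_mod i m]
    rw [pow_add, pow_mul]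
    congr 1
    rw [← aux_deg_dvd p h F E hF, ha]
    exact dvd_mul_right _ _
  · rintro ⟨j, -, rfl⟩
    symm
    have hσ : (((FiniteField.frobeniusAlgEquivOfAlgebraic F E)^j : Gal(E/F)) a)
        = a ^ (p ^ h) ^ j := by
      rw [AlgEquiv.coe_pow, FiniteField.coe_frobeniusAlgEquivOfAlgebraic_iterate, hF]
    rw [← hσ]
    exact (minpoly.algEquiv_eq _ a).symm

theorem aux_coeff (p : ℕ) (hp : p.Prime) {F : Type*} [Field F] (lam : F) (r m : ℕ)
    (g : Polynomial F) (i : ℕ) :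
    (actFin p lam r m g).coeff i = (lam ^ m)⁻¹ * g.coeff i ^ p ^ r * lam ^ i := by
  unfold actFin
  simp only [Polynomial.finsetSum_coeff, Polynomial.coeff_C_mul_X_pow]
  rw [Finset.sum_ite_eq]
  split_ifs with h1
  · rfl
  · rw [Polynomial.notMem_support_iff.mp h1, zero_pow (pow_pos hp.pos _).ne']
    simp

/-- degree is preserved by the twisted action on elements -/
theorem aux_deg_act (p h : ℕ) (hp : p.Prime) (F E : Type*) [Field F] [Field E] [Fintype F]
    [Fintype E] [Algebra F E] [CharP E p] (hF : Fintype.card F = p ^ h) (a : E)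
    (lam : F) (hl : lam ≠ 0) (r : ℕ) :
    (minpoly F (algebraMap F E lam⁻¹ * a ^ p ^ r)).natDegree = (minpoly F a).natDegree := by
  have key : ∀ s, (minpoly F (algebraMap F E lam⁻¹ * a ^ p ^ r)).natDegree ∣ s ↔
      (minpoly F a).natDegree ∣ s := by
    intro s
    rw [aux_deg_dvd p h F E hF, aux_deg_dvd p h F E hF, mul_pow, ← map_pow, ← hF,
      FiniteField.pow_card_pow]
    have h0 : algebraMap F E lam⁻¹ ≠ 0 := by simpa using hl
    rw [mul_right_inj' h0, ← pow_mul, mul_comm, pow_mul]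
    exact (aux_pow_inj p hp E r).eq_iff
  exact Nat.dvd_antisymm ((key _).2 dvd_rfl) ((key _).1 dvd_rfl)

theorem aux_act_minpoly (p h m : ℕ) (hp : p.Prime) (F E : Type*) [Field F] [Field E] [Fintype F]
    [Fintype E] [Algebra F E] [CharP E p] (hF : Fintype.card F = p ^ h) (a : E)
    (ha : (minpoly F a).natDegree = m) (lam : F) (hl : lam ≠ 0) (r : ℕ) :
    actFin p lam r m (minpoly F a) = minpoly F (algebraMap F E lam⁻¹ * a ^ p ^ r) := by
  have := Fact.mk hp
  have hai : IsIntegral F a := Algebra.IsIntegral.isIntegral a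
  have hdeg := aux_deg_act p h hp F E hF a lam hl r
  set b := algebraMap F E lam⁻¹ * a ^ p ^ r with hb
  have hbi : IsIntegral F b := Algebra.IsIntegral.isIntegral b
  have hnd : (actFin p lam r m (minpoly F a)).natDegree ≤ m := by
    rw [Polynomial.natDegree_le_iff_coeff_eq_zero]
    intro N hN
    rw [aux_coeff p hp, Polynomial.coeff_eq_zero_of_natDegree_lt (by omega),
      zero_pow (pow_pos hp.pos _).ne']
    simp
  have hlead : (actFin p lam r m (minpoly F a)).coeff m = 1 := by
    rw [aux_coeff p hp]
    have : (minpoly F a).coeff m = 1 := by rw [← ha]; exact minpoly.monic hai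
    rw [this]
    field_simp
    simp
  have hmon : (actFin p lam r m (minpoly F a)).Monic :=
    Polynomial.monic_of_natDegree_le_of_coeff_eq_one m hnd hlead
  have hroot : Polynomial.aeval b (actFin p lam r m (minpoly F a)) = 0 := by
    have h0 := minpoly.aeval F a
    have h1 : (iterateFrobenius E p r) (Polynomial.aeval a (minpoly F a)) = 0 := by
      rw [h0, map_zero]
    rw [Polynomial.aeval_eq_sum_range, map_sum] at h1
    rw [Polynomial.aeval_eq_sum_range' (Nat.lt_succ_of_le hnd)]
    rw [ha] at h1
    have h2 : ∑ i ∈ Finset.range (m+1), (actFin p lam r m (minpoly F a)).coeff i • b ^ i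
        = algebraMap F E ((lam ^ m)⁻¹) * ∑ i ∈ Finset.range (m+1),
          iterateFrobenius E p r ((minpoly F a).coeff i • a ^ i) := by
      rw [Finset.mul_sum]
      refine Finset.sum_congr rfl fun i _ => ?_
      rw [aux_coeff p hp, Algebra.smul_def, Algebra.smul_def, iterateFrobenius_def, hb]
      have h0 : algebraMap F E lam ≠ 0 := by simpa using hl
      simp only [map_mul, map_pow, map_inv₀, mul_pow, inv_pow]
      field_simp
      ring
    rw [Nat.succ_eq_add_one, h2, h1, mul_zero]
  have hdvd := minpoly.dvd F b hroot
  apply Polynomial.eq_of_monic_of_dvd_of_natDegree_le (minpoly.monic hbi) hmon hdvd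
  omega

open Polynomial in
theorem aux_surj (p h m : ℕ) (hp : p.Prime) (F E : Type*) [Field F] [Field E] [Fintype F]
    [Fintype E] [Algebra F E] (hh : 1 ≤ h) (hF : Fintype.card F = p ^ h)
    (hE : Fintype.card E = p ^ (h * m)) (g : Polynomial F) :
    g ∈ IrrSet F m ↔ ∃ a : E, (minpoly F a).natDegree = m ∧ minpoly F a = g := by
  constructor
  · rintro ⟨hmon, hirr, hdeg⟩
    have hfr : Module.finrank F E = m := by
      have h1 := Module.card_eq_pow_finrank (K := F) (V := E)
      rw [hE, hF, ← pow_mul] at h1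
      have h2 := Nat.pow_right_injective hp.two_le h1
      exact (Nat.eq_of_mul_eq_mul_left (by omega) h2).symm
    have := Fact.mk hirr
    have hfa : Module.finrank F (AdjoinRoot g) = m := by
      rw [← hdeg]; exact finrank_quotient_span_eq_natDegree
    obtain ⟨f⟩ := FiniteField.nonempty_algHom_of_finrank_dvd (F := F) (K := AdjoinRoot g) (L := E)
      (by rw [hfa, hfr])
    have hmin : minpoly F (f (AdjoinRoot.root g)) = g := by
      symm
      apply minpoly.eq_of_irreducible_of_monic hirr _ hmon
      rw [aeval_algHom_apply, AdjoinRoot.aeval_eq, AdjoinRoot.mk_self, map_zero]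
    exact ⟨f (AdjoinRoot.root g), by rw [hmin, hdeg], hmin⟩
  · rintro ⟨a, ha, rfl⟩
    have hai : IsIntegral F a := Algebra.IsIntegral.isIntegral a
    exact ⟨minpoly.monic hai, minpoly.irreducible hai, ha⟩

open scoped Classical in
theorem aux_burnside {α T : Type*} [Fintype T] (X : Finset α) (act : T → α → α)
    (mul : T → T → T) (one : T) (hcl : ∀ t, ∀ x ∈ X, act t x ∈ X)
    (hone : ∀ x ∈ X, act one x = x)
    (hmul : ∀ s t, ∀ x ∈ X, act (mul s t) x = act s (act t x))
    (hinj : ∀ t, Function.Injective (fun s => mul s t)) :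
    ∑ t : T, (X.filter (fun x => act t x = x)).card =
      Fintype.card T * (X.image (fun x => X.filter (fun y => ∃ t, y = act t x))).card := by
  have hbij : ∀ t, Function.Bijective (fun s => mul s t) := fun t =>
    Finite.injective_iff_bijective.mp (hinj t)
  set orb : α → Finset α := fun x => X.filter (fun y => ∃ t, y = act t x) with horb
  have hsymm : ∀ x ∈ X, ∀ t, ∃ s, x = act s (act t x) := by
    intro x hx t
    obtain ⟨s, hs⟩ := (hbij t).2 one
    refine ⟨s, ?_⟩
    rw [← hmul s t x hx]
    simp only at hs
    rw [hs, hone x hx]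
  have horbeq : ∀ x ∈ X, ∀ y ∈ X, orb y = orb x ↔ y ∈ orb x := by
    intro x hx y hy
    constructor
    · intro he
      rw [← he]
      exact Finset.mem_filter.2 ⟨hy, one, (hone y hy).symm⟩
    · intro hyx
      obtain ⟨-, t, rfl⟩ := Finset.mem_filter.1 hyx
      ext z
      simp only [horb, Finset.mem_filter]
      refine and_congr_right fun hz => ?_
      constructor
      · rintro ⟨s, rfl⟩
        exact ⟨mul s t, (hmul s t x hx).symm⟩
      · rintro ⟨s, rfl⟩
        obtain ⟨u, hu⟩ := hsymm x hx t
        refine ⟨mul s u, ?_⟩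
        rw [hmul s u _ hy, ← hu]
  have hswap : ∑ t : T, (X.filter (fun x => act t x = x)).card =
      ∑ x ∈ X, (Finset.univ.filter (fun t => act t x = x)).card := by
    simp only [Finset.card_filter]
    rw [Finset.sum_comm]
  rw [hswap, ← Finset.sum_fiberwise_of_maps_to (t := X.image orb) (g := orb)
    (fun x hx => Finset.mem_image_of_mem _ hx), mul_comm, ← smul_eq_mul, ← Finset.sum_const]
  refine Finset.sum_congr rfl fun S hS => ?_
  obtain ⟨x0, hx0, rfl⟩ := Finset.mem_image.1 hS
  have h1 : X.filter (fun x => orb x = orb x0) = orb x0 := by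
    ext y
    simp only [Finset.mem_filter]
    constructor
    · rintro ⟨hy, he⟩
      exact (horbeq x0 hx0 y hy).1 he
    · intro hy
      have hyX : y ∈ X := (Finset.mem_filter.1 hy).1
      exact ⟨hyX, (horbeq x0 hx0 y hyX).2 hy⟩
  rw [h1]
  have h2 : ∀ x ∈ orb x0, (Finset.univ.filter (fun t => act t x = x)).card =
      (Finset.univ.filter (fun t => act t x0 = x)).card := by
    intro x hx
    obtain ⟨-, s, hs⟩ := Finset.mem_filter.1 hx
    refine Finset.card_bijective (fun t => mul t s) (hbij s) fun t => ?_
    simp only [Finset.mem_filter, Finset.mem_univ, true_and]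
    rw [hmul t s x0 hx0, ← hs]
  rw [Finset.sum_congr rfl h2, ← Finset.card_univ]
  symm
  apply Finset.card_eq_sum_card_fiberwise
  intro t _
  exact Finset.mem_filter.2 ⟨hcl t x0 hx0, t, rfl⟩

theorem aux_moebius (m k : ℕ) (hm : 0 < m) (hk : k ∣ m) :
    ∑ d ∈ m.divisors, (if k ∣ m / d then (ArithmeticFunction.moebius d : ℚ) else 0) =
      if k = m then 1 else 0 := by
  obtain ⟨c, rfl⟩ := hk
  have hk0 : 0 < k := Nat.pos_of_mul_pos_right hm
  have hc0 : 0 < c := Nat.pos_of_mul_pos_left hm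
  have hs : (k * c).divisors.filter (fun d => k ∣ k * c / d) = c.divisors := by
    ext d
    simp only [Finset.mem_filter, Nat.mem_divisors]
    constructor
    · rintro ⟨⟨⟨e, he⟩, -⟩, hd⟩
      have hd0 : 0 < d := Nat.pos_of_ne_zero (by rintro rfl; simp at he; omega)
      rw [he, Nat.mul_div_cancel_left _ hd0] at hd
      obtain ⟨f, rfl⟩ := hd
      refine ⟨⟨f, ?_⟩, hc0.ne'⟩
      apply Nat.eq_of_mul_eq_mul_left hk0
      rw [he]; ring
    · rintro ⟨⟨f, rfl⟩, -⟩
      have hd0 : 0 < d := Nat.pos_of_mul_pos_right hc0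
      refine ⟨⟨⟨k * f, by ring⟩, hm.ne'⟩, ?_⟩
      rw [show k * (d * f) = d * (k * f) by ring, Nat.mul_div_cancel_left _ hd0]
      exact dvd_mul_right _ _
  rw [← Finset.sum_filter, hs]
  have h1 : ((ArithmeticFunction.moebius * ArithmeticFunction.zeta :
      ArithmeticFunction ℤ) c) = (1 : ArithmeticFunction ℤ) c := by
    rw [ArithmeticFunction.moebius_mul_coe_zeta]
  rw [ArithmeticFunction.coe_mul_zeta_apply, ArithmeticFunction.one_apply] at h1
  have h2 : k = k * c ↔ c = 1 := by
    constructor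
    · intro h; exact (Nat.eq_of_mul_eq_mul_left hk0 (by omega : k * c = k * 1))
    · rintro rfl; simp
  simp only [h2]
  exact_mod_cast h1

open scoped Classical in
theorem aux_ncount (p h m : ℕ) (F E : Type*) [Field F] [Field E] [Fintype F]
    [Fintype E] [Algebra F E] (hm : 2 ≤ m) (hF : Fintype.card F = p ^ h)
    (hE : Fintype.card E = p ^ (h * m)) (lam : F) (r j : ℕ) :
    ∑ d ∈ m.divisors, (ArithmeticFunction.moebius d : ℚ) *
      (Ncount p h F E lam r j (m / d) : ℚ) =
    ((Finset.univ.filter (fun a : E => (minpoly F a).natDegree = m ∧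
      a ^ p ^ r = algebraMap F E lam * a ^ (p ^ h) ^ j)).card : ℚ) := by
  have h1 : ∀ d, (Ncount p h F E lam r j (m / d) : ℚ) = ∑ a : E,
      if (a ≠ 0 ∧ a ^ p ^ r = algebraMap F E lam * a ^ (p ^ h) ^ j) then
        (if (minpoly F a).natDegree ∣ m / d then 1 else 0) else 0 := by
    intro d
    unfold Ncount
    rw [Nat.card_eq_fintype_card, Fintype.card_subtype, Finset.card_filter]
    push_cast
    refine Finset.sum_congr rfl fun a _ => ?_
    have hd := aux_deg_dvd p h F E hF a (m / d)
    split_ifs <;> first | rfl | tauto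
  simp only [h1, Finset.mul_sum]
  rw [Finset.sum_comm, Finset.card_filter]
  push_cast
  refine Finset.sum_congr rfl fun a _ => ?_
  have hdm : (minpoly F a).natDegree ∣ m := by
    rw [aux_deg_dvd p h F E hF, ← pow_mul, ← hE]
    exact FiniteField.pow_card a
  have h2 := aux_moebius m _ (by omega) hdm
  by_cases hP : a ≠ 0 ∧ a ^ p ^ r = algebraMap F E lam * a ^ (p ^ h) ^ j
  · simp only [if_pos hP, mul_ite, mul_one, mul_zero]
    rw [h2]
    simp only [hP.2, and_true]
  · simp only [if_neg hP, mul_zero, Finset.sum_const_zero]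
    rw [if_neg]
    rintro ⟨ha, hb⟩
    apply hP
    refine ⟨?_, hb⟩
    rintro rfl
    rw [minpoly.zero, Polynomial.natDegree_X] at ha
    omega

open scoped Classical in
theorem aux_fix (p h m : ℕ) (hp : p.Prime) (F E : Type*) [Field F] [Field E] [Fintype F]
    [Fintype E] [Algebra F E] [CharP F p] [CharP E p] (hh : 1 ≤ h) (hm : 2 ≤ m)
    (hF : Fintype.card F = p ^ h)
    (hE : Fintype.card E = p ^ (h * m)) (lam : F) (hl : lam ≠ 0) (r : ℕ)
    (X : Finset (Polynomial F)) (hX : ∀ g, g ∈ X ↔ g ∈ IrrSet F m) :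
    ∑ j ∈ Finset.range m, (Finset.univ.filter (fun a : E => (minpoly F a).natDegree = m ∧
      a ^ p ^ r = algebraMap F E lam * a ^ (p ^ h) ^ j)).card =
    m * (X.filter (fun g => actFin p lam r m g = g)).card := by
  have h0 : algebraMap F E lam ≠ 0 := by simpa using hl
  set B : Finset E := Finset.univ.filter (fun a : E => (minpoly F a).natDegree = m ∧
    actFin p lam r m (minpoly F a) = minpoly F a) with hB
  have hfixiff : ∀ a : E, (minpoly F a).natDegree = m →
      (actFin p lam r m (minpoly F a) = minpoly F a ↔
        ∃ j < m, a ^ p ^ r = algebraMap F E lam * a ^ (p ^ h) ^ j) := by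
    intro a ha
    rw [aux_act_minpoly p h m hp F E hF a ha lam hl r,
      aux_conj p h m hp (by omega) F E hF _ _ ha]
    refine exists_congr fun j => and_congr_right fun _ => ?_
    rw [map_inv₀, inv_mul_eq_iff_eq_mul₀ h0]
  have hBl : ∑ j ∈ Finset.range m, (Finset.univ.filter (fun a : E => (minpoly F a).natDegree = m ∧
      a ^ p ^ r = algebraMap F E lam * a ^ (p ^ h) ^ j)).card = B.card := by
    rw [← Finset.card_biUnion]
    · congr 1
      ext a
      simp only [hB, Finset.mem_biUnion, Finset.mem_filter, Finset.mem_univ, true_and,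
        Finset.mem_range]
      constructor
      · rintro ⟨j, hj, ha, hb⟩
        exact ⟨ha, (hfixiff a ha).2 ⟨j, hj, hb⟩⟩
      · rintro ⟨ha, hb⟩
        obtain ⟨j, hj, hb⟩ := (hfixiff a ha).1 hb
        exact ⟨j, hj, ha, hb⟩
    · intro i hi j hj hij
      rw [Function.onFun, Finset.disjoint_left]
      intro a ha hb
      simp only [Finset.mem_filter, Finset.mem_univ, true_and] at ha hb
      apply hij
      refine aux_exp_unique p h m hp F E hF a ha.1 i j (by simpa using hi) (by simpa using hj) ?_
      exact mul_left_cancel₀ h0 (ha.2.symm.trans hb.2)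
  rw [hBl, Finset.card_eq_sum_card_fiberwise (f := fun a => minpoly F a)
    (t := X.filter (fun g => actFin p lam r m g = g))]
  · rw [mul_comm, ← smul_eq_mul, ← Finset.sum_const]
    refine Finset.sum_congr rfl fun g hg => ?_
    obtain ⟨hgX, hgf⟩ := Finset.mem_filter.1 hg
    obtain ⟨a, ha, rfl⟩ := (aux_surj p h m hp F E hh hF hE g).1 ((hX g).1 hgX)
    have : B.filter (fun b => minpoly F b = minpoly F a) =
        (Finset.range m).image (fun j => a ^ (p ^ h) ^ j) := by
      ext b
      simp only [hB, Finset.mem_filter, Finset.mem_univ, true_and, Finset.mem_image,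
        Finset.mem_range]
      constructor
      · rintro ⟨-, hb⟩
        obtain ⟨j, hj, hb⟩ := (aux_conj p h m hp (by omega) F E hF a b ha).1 hb
        exact ⟨j, hj, hb.symm⟩
      · rintro ⟨j, hj, hb⟩
        have hb' := (aux_conj p h m hp (by omega) F E hF a b ha).2 ⟨j, hj, hb.symm⟩
        rw [hb']
        exact ⟨⟨ha, hgf⟩, rfl⟩
    rw [this, Finset.card_image_of_injOn, Finset.card_range]
    intro i hi j hj hij
    exact aux_exp_unique p h m hp F E hF a ha i j (by simpa using hi) (by simpa using hj) hij
  · intro a ha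
    obtain ⟨-, ha, hb⟩ := Finset.mem_filter.1 ha
    exact Finset.mem_coe.2 (Finset.mem_filter.2
      ⟨(hX _).2 ((aux_surj p h m hp F E hh hF hE _).2 ⟨a, ha, rfl⟩), hb⟩)

open scoped Classical in
/-- **Statement 16.** The number of `G`-orbits on the monic irreducible polynomials of
degree `m` in `𝔽_q[x]` is
`M(q,m) = (1/((q−1)hnm)) ∑_{λ∈𝔽_qˣ} ∑_{r<hn} ∑_{j<m} ∑_{d∣m} μ(d) N_{r,j}(m/d, λ)`. -/
theorem petit_stmt16 (p h n m : ℕ) (hp : p.Prime) (hh : 1 ≤ h) (hn : 2 ≤ n) (hm : 2 ≤ m)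
    (F E : Type*) [Field F] [Field E] [Fintype F] [Fintype E] [Algebra F E]
    (hF : Fintype.card F = p ^ h) (hE : Fintype.card E = p ^ (h * m)) :
    (Nat.card (orbitSet p h n m F) : ℚ) =
      (1 / (((p : ℚ) ^ h - 1) * h * n * m)) *
        ∑ lam : Fˣ, ∑ r ∈ Finset.range (h * n), ∑ j ∈ Finset.range m,
          ∑ d ∈ m.divisors,
            (ArithmeticFunction.moebius d : ℚ) *
              (Ncount p h F E (lam : F) r j (m / d) : ℚ) := by
  have := Fact.mk hp
  have hcF : CharP F p := by
    obtain ⟨c, hc⟩ := CharP.exists F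
    obtain ⟨k, hcp, hck⟩ := FiniteField.card F c
    rw [hF] at hck
    have : p = c := by
      have h1 : p ∣ c ^ (k : ℕ) := hck ▸ dvd_pow_self p (by omega)
      exact (Nat.prime_dvd_prime_iff_eq hp hcp).1 (hp.dvd_of_dvd_pow h1)
    rw [this]; exact hc
  have hcE : CharP E p := charP_of_injective_algebraMap (algebraMap F E).injective p
  have hhn : 0 < h * n := Nat.mul_pos (by omega) (by omega)
  have : NeZero (h * n) := ⟨hhn.ne'⟩
  -- the finite set of monic irreducible polynomials of degree m
  set X : Finset (Polynomial F) := (Finset.univ.filter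
    (fun a : E => (minpoly F a).natDegree = m)).image (fun a => minpoly F a) with hXdef
  have hX : ∀ g, g ∈ X ↔ g ∈ IrrSet F m := by
    intro g
    rw [aux_surj p h m hp F E hh hF hE g]
    simp [hXdef]
  let act : Fˣ × Fin (h * n) → Polynomial F → Polynomial F :=
    fun t g => actFin p (t.1 : F) t.2 m g
  let mul : Fˣ × Fin (h * n) → Fˣ × Fin (h * n) → Fˣ × Fin (h * n) :=
    fun s t => (t.1 ^ p ^ (s.2 : ℕ) * s.1, s.2 + t.2)
  have hper : ∀ (x : F) (s : ℕ), x ^ p ^ (s % (h * n)) = x ^ p ^ s := by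
    intro x s
    conv_rhs => rw [← Nat.mod_add_div s (h * n)]
    rw [pow_add, pow_mul x, show h * n * (s / (h * n)) = h * (n * (s / (h * n))) by ring,
      pow_mul p h, ← hF, FiniteField.pow_card_pow]
  have hB := aux_burnside X act mul (1, 0) ?_ ?_ ?_ ?_
  rotate_left
  · rintro ⟨lam, r⟩ x hx
    obtain ⟨a, ha, rfl⟩ := (aux_surj p h m hp F E hh hF hE x).1 ((hX x).1 hx)
    refine (hX _).2 ((aux_surj p h m hp F E hh hF hE _).2 ⟨_, ?_,
      (aux_act_minpoly p h m hp F E hF a ha lam lam.ne_zero r).symm⟩)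
    rw [aux_deg_act p h hp F E hF a lam lam.ne_zero r, ha]
  · intro x _
    ext i
    simp [act, aux_coeff p hp]
  · rintro ⟨l, r⟩ ⟨k, s⟩ x _
    ext i
    simp only [act, mul, aux_coeff p hp, Fin.val_add, hper]
    push_cast
    have hl := l.ne_zero
    have hk := k.ne_zero
    rw [pow_add p]
    simp only [mul_pow, inv_pow, ← pow_mul]
    rw [mul_comm (p ^ (s : ℕ)) (p ^ (r : ℕ)), mul_comm m, mul_comm i, mul_inv]
    ring
  · rintro ⟨k, s⟩ ⟨l, r⟩ ⟨l', r'⟩ he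
    simp only [mul, Prod.mk.injEq, add_left_inj] at he
    obtain ⟨h1, rfl⟩ := he
    simpa using h1
  have horb : Nat.card (orbitSet p h n m F) =
      (X.image (fun x => X.filter (fun y => ∃ t, y = act t x))).card := by
    have : orbitSet p h n m F = (fun S : Finset (Polynomial F) => (S : Set (Polynomial F))) ''
        (X.image (fun x => X.filter (fun y => ∃ t, y = act t x)) :
          Finset (Finset (Polynomial F))) := by
      have hsets : ∀ g, ((X.filter (fun y => ∃ t, y = act t g) : Finset _) : Set (Polynomial F)) =
          {g' ∈ IrrSet F m | ∃ lam : F, lam ≠ 0 ∧ ∃ r < h * n, g' = actFin p lam r m g} := by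
        intro g
        ext y
        simp only [Finset.coe_filter, Set.mem_ofPred_eq, hX]
        refine and_congr_right fun _ => ?_
        constructor
        · rintro ⟨⟨l, r⟩, rfl⟩
          exact ⟨l, l.ne_zero, r, r.2, rfl⟩
        · rintro ⟨l, hl, r, hr, rfl⟩
          exact ⟨(Units.mk0 l hl, ⟨r, hr⟩), rfl⟩
      ext S
      simp only [orbitSet, Set.mem_ofPred_eq, Set.mem_image, Finset.mem_coe, Finset.mem_image]
      constructor
      · rintro ⟨g, hg, rfl⟩
        exact ⟨_, ⟨g, (hX g).2 hg, rfl⟩, hsets g⟩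
      · rintro ⟨_, ⟨g, hg, rfl⟩, rfl⟩
        exact ⟨g, (hX g).1 hg, hsets g⟩
    rw [this, Nat.card_coe_set_eq, Set.ncard_image_of_injective _ Finset.coe_injective,
      Set.ncard_coe_finset]
  have hB : ∑ t, (X.filter (fun x => act t x = x)).card =
      Fintype.card (Fˣ × Fin (h * n)) * Nat.card (orbitSet p h n m F) := by
    rw [horb]
    convert hB
  rw [Fintype.card_prod, Fintype.card_units, hF, Fintype.card_fin,
    Fintype.sum_prod_type] at hB
  have hsum : ∑ lam : Fˣ, ∑ r ∈ Finset.range (h * n), ∑ j ∈ Finset.range m,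
      ∑ d ∈ m.divisors, (ArithmeticFunction.moebius d : ℚ) *
        (Ncount p h F E (lam : F) r j (m / d) : ℚ) =
      m * ((∑ lam : Fˣ, ∑ r : Fin (h * n),
        (X.filter (fun x => act (lam, r) x = x)).card : ℕ) : ℚ) := by
    push_cast
    rw [Finset.mul_sum]
    refine Finset.sum_congr rfl fun lam _ => ?_
    rw [Finset.mul_sum, Finset.sum_range]
    refine Finset.sum_congr rfl fun r _ => ?_
    have := aux_fix p h m hp F E hh hm hF hE (lam : F) lam.ne_zero r X hX
    rw [Finset.sum_congr rfl fun j _ => aux_ncount p h m F E hm hF hE (lam : F) r j]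
    exact_mod_cast this
  rw [hsum, hB]
  have hp1 : 1 < p ^ h := Nat.one_lt_pow (by omega) hp.one_lt
  push_cast [Nat.cast_sub hp1.le]
  have hq : ((p : ℚ) ^ h - 1) ≠ 0 := by
    have : (1 : ℚ) < (p : ℚ) ^ h := by exact_mod_cast hp1
    linarith
  have h1 : (h : ℚ) ≠ 0 := by exact_mod_cast (by omega : h ≠ 0)
  have h2 : (n : ℚ) ≠ 0 := by exact_mod_cast (by omega : n ≠ 0)
  have h3 : (m : ℚ) ≠ 0 := by exact_mod_cast (by omega : m ≠ 0)
  field_simp
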